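/- Let C ⊂ ℂ⁸ be the affine cone over 𝒳 and define the subsets D₁^± := {v ∈ C : X₂ − X₃ = 0 and Y₁ ± Y₃ = 0}, D₂^± := {v ∈ C : X₀X₂ + X₁X₃ = 0 and Y₀Y₁ ± Y₂Y₃ = 0}, D₃^± := {v ∈ C : X₀ − X₁ − X₂ − X₃ = 0 and Y₁(X₁+X₃) ± (√2/2)·Y₂Y₃ = 0}. Then, with 𝒢 acting on subsets of ℂ⁸ by taking images: for every i ∈ {1,2,3} there exists g ∈ 𝒢 with g(Dᵢ⁺) = Dᵢ⁻ (so Dᵢ⁺ and Dᵢ⁻ lie in the same 𝒢-orbit), and the 𝒢-orbit {g(Dᵢ⁺) : g ∈ 𝒢} has cardinality 48 for i = 1, cardinality 12 for i = 2, and cardinality 128 for i = 3. -/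

import Mathlib

noncomputable section

open Matrix Complex

/-- A matrix whose `i`-th row has the single entry `c i` in column `σ i`;
it sends the coordinate vector `v` to the vector `i ↦ c i * v (σ i)`. -/
def mkM (σ : Fin 8 → Fin 8) (c : Fin 8 → ℂ) : Matrix (Fin 8) (Fin 8) ℂ :=
  Matrix.of fun i j => if j = σ i then c i else 0

/-- `U₁ : (Y₀,Y₁,Y₃,Y₂,X₀,X₃,X₂,X₁)` -/
def U1M : Matrix (Fin 8) (Fin 8) ℂ := mkM ![0,1,3,2,4,7,6,5] (fun _ => 1)

/-- `U₂ : (Y₀,Y₃,Y₂,Y₁,X₀,X₁,X₃,X₂)` -/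
def U2M : Matrix (Fin 8) (Fin 8) ℂ := mkM ![0,3,2,1,4,5,7,6] (fun _ => 1)

/-- `T : (Y₀,−iY₁,Y₂,−iY₃,X₁,X₀,X₃,X₂)` -/
def TM : Matrix (Fin 8) (Fin 8) ℂ :=
  mkM ![0,1,2,3,5,4,7,6] ![1, -Complex.I, 1, -Complex.I, 1, 1, 1, 1]

/-- `J : √2·(X₀,X₁,X₂,X₃,Y₀/2,Y₁/2,Y₂/2,Y₃/2)` -/
def JM : Matrix (Fin 8) (Fin 8) ℂ :=
  mkM ![4,5,6,7,0,1,2,3]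
    ![(Real.sqrt 2 : ℂ), (Real.sqrt 2 : ℂ), (Real.sqrt 2 : ℂ), (Real.sqrt 2 : ℂ),
      (Real.sqrt 2 : ℂ)/2, (Real.sqrt 2 : ℂ)/2, (Real.sqrt 2 : ℂ)/2, (Real.sqrt 2 : ℂ)/2]

/-- The scalar matrix `i·I₈`. -/
def iI : Matrix (Fin 8) (Fin 8) ℂ := Complex.I • (1 : Matrix (Fin 8) (Fin 8) ℂ)

/-- The group `𝒢 ⊆ GL(8,ℂ)` generated by `U₁, U₂, T, J`. -/
def GG : Subgroup (GL (Fin 8) ℂ) :=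
  Subgroup.closure {g | (↑g : Matrix (Fin 8) (Fin 8) ℂ) = U1M ∨
    (↑g : Matrix (Fin 8) (Fin 8) ℂ) = U2M ∨ (↑g : Matrix (Fin 8) (Fin 8) ℂ) = TM ∨
    (↑g : Matrix (Fin 8) (Fin 8) ℂ) = JM}

/-- The group `𝒵` of scalar matrices generated by `i·I₈`. -/
def ZZ : Subgroup (GL (Fin 8) ℂ) :=
  Subgroup.closure {g | (↑g : Matrix (Fin 8) (Fin 8) ℂ) = iI}

/-- The affine cone over `𝒳`: solutions of the four quadric equations. -/
def ConeSet : Set (Fin 8 → ℂ) :=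
  {v | v 0 ^ 2 = v 4 ^ 2 + v 5 ^ 2 + v 6 ^ 2 + v 7 ^ 2 ∧
       v 1 ^ 2 = v 4 ^ 2 - v 5 ^ 2 + v 6 ^ 2 - v 7 ^ 2 ∧
       v 2 ^ 2 = v 4 ^ 2 + v 5 ^ 2 - v 6 ^ 2 - v 7 ^ 2 ∧
       v 3 ^ 2 = v 4 ^ 2 - v 5 ^ 2 - v 6 ^ 2 + v 7 ^ 2}

/-- `D₁^± : X₂ − X₃ = Y₁ ± Y₃ = 0` (with `ε = 1` for `+`, `ε = −1` for `−`). -/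
def D1 (ε : ℂ) : Set (Fin 8 → ℂ) :=
  {v ∈ ConeSet | v 6 - v 7 = 0 ∧ v 1 + ε * v 3 = 0}

/-- `D₂^± : X₀X₂ + X₁X₃ = Y₀Y₁ ± Y₂Y₃ = 0`. -/
def D2 (ε : ℂ) : Set (Fin 8 → ℂ) :=
  {v ∈ ConeSet | v 4 * v 6 + v 5 * v 7 = 0 ∧ v 0 * v 1 + ε * (v 2 * v 3) = 0}

/-- `D₃^± : X₀ − X₁ − X₂ − X₃ = Y₁(X₁+X₃) ± (√2/2)Y₂Y₃ = 0`. -/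
def D3 (ε : ℂ) : Set (Fin 8 → ℂ) :=
  {v ∈ ConeSet | v 4 - v 5 - v 6 - v 7 = 0 ∧
    v 1 * (v 5 + v 7) + ε * (((Real.sqrt 2 : ℂ) / 2) * (v 2 * v 3)) = 0}

/-- The image of a subset of `ℂ⁸` under an element of `GL(8,ℂ)`. -/
def actSet (g : GL (Fin 8) ℂ) (S : Set (Fin 8 → ℂ)) : Set (Fin 8 → ℂ) :=
  (fun v => Matrix.mulVec (↑g : Matrix (Fin 8) (Fin 8) ℂ) v) '' S

/-- The `𝒢`-orbit of a subset of `ℂ⁸`. -/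
def orbitOf (S : Set (Fin 8 → ℂ)) : Set (Set (Fin 8 → ℂ)) :=
  {S' | ∃ g ∈ GG, actSet g S = S'}

/-- The generators `U₁, U₂, T, J`. -/
def genM : Fin 4 → Matrix (Fin 8) (Fin 8) ℂ := ![U1M, U2M, TM, JM]

theorem mkM_mulVec (σ : Fin 8 → Fin 8) (c : Fin 8 → ℂ) (v : Fin 8 → ℂ) :
    mkM σ c *ᵥ v = fun i => c i * v (σ i) := by
  funext i
  simp [mkM, Matrix.mulVec, dotProduct]

theorem mkM_mul (σ τ : Fin 8 → Fin 8) (c d : Fin 8 → ℂ) :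
    mkM σ c * mkM τ d = mkM (τ ∘ σ) (fun i => c i * d (σ i)) := by
  ext i j
  rw [Matrix.mul_apply, Finset.sum_eq_single (σ i)] <;> simp +contextual [mkM]

theorem mkM_id_one : mkM id (fun _ => 1) = 1 := by
  ext i j
  simp [mkM, Matrix.one_apply, eq_comm]

theorem ofReal_sqrt_two_sq : (Real.sqrt 2 : ℂ) ^ 2 = 2 := by
  rw [← ofReal_pow, Real.sq_sqrt (by norm_num)]
  norm_num

theorem genM_pow_four (k : Fin 4) : genM k ^ 4 = 1 := by
  have h2 := ofReal_sqrt_two_sq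
  have hI := Complex.I_sq
  rw [← mkM_id_one, show (4 : ℕ) = 2 * 2 from rfl, pow_mul, sq (genM k), sq]
  fin_cases k <;>
    simp only [genM, U1M, U2M, TM, JM, mkM_mul, Fin.zero_eta, Fin.mk_one, Fin.reduceFinMk,
      Matrix.cons_val] <;>
    congr 1 <;> funext i <;> fin_cases i <;> simp <;> grind

/-- The generators as elements of `GL(8,ℂ)`. -/
def genGL (k : Fin 4) : GL (Fin 8) ℂ :=
  ⟨genM k, genM k ^ 3, by rw [← pow_succ', genM_pow_four], by rw [← pow_succ, genM_pow_four]⟩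

theorem genGL_mem (k : Fin 4) : genGL k ∈ GG := by
  apply Subgroup.subset_closure
  fin_cases k <;> simp [genGL, genM]

theorem genGL_pow_four (k : Fin 4) : genGL k ^ 4 = 1 :=
  Units.ext (by simpa [genGL] using genM_pow_four k)

theorem GG_le {H : Subgroup (GL (Fin 8) ℂ)} (h : ∀ k, genGL k ∈ H) : GG ≤ H := by
  refine (Subgroup.closure_le H).2 fun g hg => ?_
  have key : ∀ k, (g : Matrix (Fin 8) (Fin 8) ℂ) = genM k → g ∈ H := fun k hk =>
    (Units.ext hk : g = genGL k) ▸ h k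
  rcases hg with hg | hg | hg | hg
  exacts [key 0 hg, key 1 hg, key 2 hg, key 3 hg]

theorem actSet_one (S : Set (Fin 8 → ℂ)) : actSet 1 S = S := by
  simp [actSet]

theorem actSet_mul (g h : GL (Fin 8) ℂ) (S : Set (Fin 8 → ℂ)) :
    actSet (g * h) S = actSet g (actSet h S) := by
  simp [actSet, Set.image_image, Matrix.mulVec_mulVec]

theorem actSet_mono (g : GL (Fin 8) ℂ) {S S' : Set (Fin 8 → ℂ)} (h : S ⊆ S') :
    actSet g S ⊆ actSet g S' :=
  Set.image_mono h

section Family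

variable {ι : Type*} {F : ι → Set (Fin 8 → ℂ)} {p : Fin 4 → ι → ι}

/-- A family of sets on which the generators act through maps `p k` of the index type. -/
structure GenEquivariant (F : ι → Set (Fin 8 → ℂ)) (p : Fin 4 → ι → ι) : Prop where
  pow_four : ∀ k i, p k (p k (p k (p k i))) = i
  maps : ∀ k i, ∀ v ∈ F i, genM k *ᵥ v ∈ F (p k i)

theorem GenEquivariant.actSet_genGL (h : GenEquivariant F p) (k : Fin 4) (i : ι) :
    actSet (genGL k) (F i) = F (p k i) := by
  have sub : ∀ j, actSet (genGL k) (F j) ⊆ F (p k j) := fun j => by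
    rintro _ ⟨v, hv, rfl⟩
    exact h.maps k j v hv
  refine (sub i).antisymm ?_
  have h1 := (actSet_mono (genGL k) (sub (p k i))).trans (sub _)
  have h2 := actSet_mono (genGL k) ((actSet_mono (genGL k) h1).trans (sub _))
  rwa [h.pow_four, ← actSet_mul, ← actSet_mul, ← actSet_mul, ← pow_two, ← pow_succ, ← pow_succ,
    genGL_pow_four, actSet_one] at h2

theorem GenEquivariant.exists_perm (h : GenEquivariant F p) {g : GL (Fin 8) ℂ} (hg : g ∈ GG) :
    ∃ π : Equiv.Perm ι, ∀ i, actSet g (F i) = F (π i) := by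
  let H : Subgroup (GL (Fin 8) ℂ) :=
    { carrier := {g | ∃ π : Equiv.Perm ι, ∀ i, actSet g (F i) = F (π i)}
      one_mem' := ⟨1, fun i => by simp [actSet_one]⟩
      mul_mem' := by
        rintro a b ⟨π, hπ⟩ ⟨ρ, hρ⟩
        exact ⟨π * ρ, fun i => by simp [actSet_mul, hπ, hρ]⟩
      inv_mem' := by
        rintro a ⟨π, hπ⟩
        refine ⟨π⁻¹, fun i => ?_⟩
        have := hπ (π⁻¹ i)
        rw [show π (π⁻¹ i) = i from π.apply_symm_apply i] at this
        rw [← this, ← actSet_mul, inv_mul_cancel, actSet_one] }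
  exact GG_le (H := H) (fun k => ⟨⟨p k, fun i => p k (p k (p k i)), h.pow_four k, h.pow_four k⟩,
    h.actSet_genGL k⟩) hg

theorem GenEquivariant.exists_actSet_eq_foldr (h : GenEquivariant F p) (w : List (Fin 4)) (i : ι) :
    ∃ g ∈ GG, actSet g (F i) = F (w.foldr p i) := by
  induction w with
  | nil => exact ⟨1, one_mem _, actSet_one _⟩
  | cons k w ih =>
    obtain ⟨g, hg, hgi⟩ := ih
    exact ⟨genGL k * g, mul_mem (genGL_mem k) hg, by
      rw [actSet_mul, hgi, h.actSet_genGL, List.foldr_cons]⟩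

/-- If the generators act transitively on the index type and `F i₀` determines `i₀`, then the orbit
of `F i₀` is in bijection with the index type. -/
theorem GenEquivariant.card_orbitOf (h : GenEquivariant F p) {i₀ : ι}
    (reach : ∀ i, ∃ w : List (Fin 4), w.foldr p i₀ = i) (inj : ∀ i, F i₀ ⊆ F i → i = i₀) :
    Nat.card (orbitOf (F i₀)) = Nat.card ι := by
  have trans : ∀ i, ∃ g ∈ GG, actSet g (F i₀) = F i := fun i => by
    obtain ⟨w, rfl⟩ := reach i
    exact h.exists_actSet_eq_foldr w i₀
  have hinj : Function.Injective F := fun i j hij => by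
    obtain ⟨g, hg, hgi⟩ := trans i
    obtain ⟨π, hπ⟩ := h.exists_perm (inv_mem hg)
    have hi : actSet g⁻¹ (F i) = F i₀ := by
      rw [← hgi, ← actSet_mul, inv_mul_cancel, actSet_one]
    have h1 := inj (π i) (by rw [← hπ, hi])
    have h2 := inj (π j) (by rw [← hπ, ← hij, hi])
    exact π.injective (h1.trans h2.symm)
  have horb : orbitOf (F i₀) = Set.range F := by
    ext S
    constructor
    · rintro ⟨g, hg, rfl⟩
      obtain ⟨π, hπ⟩ := h.exists_perm hg
      exact ⟨π i₀, (hπ i₀).symm⟩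
    · rintro ⟨i, rfl⟩
      exact trans i
  rw [horb, Nat.card_congr (Equiv.ofInjective F hinj)]

end Family

/-- The `X`-coordinates of a vector. -/
def coordX (v : Fin 8 → ℂ) : Fin 4 → ℂ := ![v 4, v 5, v 6, v 7]

/-- The `Y`-coordinates of a vector. -/
def coordY (v : Fin 8 → ℂ) : Fin 4 → ℂ := ![v 0, v 1, v 2, v 3]

theorem genM_mulVec_mem_ConeSet (k : Fin 4) {v : Fin 8 → ℂ} (hv : v ∈ ConeSet) :
    genM k *ᵥ v ∈ ConeSet := by
  obtain ⟨h0, h1, h2, h3⟩ := hv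
  have hs := ofReal_sqrt_two_sq
  have hI := Complex.I_sq
  fin_cases k <;>
    simp only [genM, U1M, U2M, TM, JM, mkM_mulVec, ConeSet, Set.mem_ofPred_eq, Fin.zero_eta,
      Fin.mk_one, Fin.reduceFinMk, Matrix.cons_val] <;>
    refine ⟨?_, ?_, ?_, ?_⟩ <;> grind

/-- The two blocks of the partition of `{0,1,2,3}` into pairs that joins `0` and `m + 1`;
the block containing `0` is the one with index `true`. -/
def block : Fin 3 → Bool → Fin 4 × Fin 4
  | 0, true => (0, 1)
  | 0, false => (2, 3)
  | 1, true => (0, 2)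
  | 1, false => (1, 3)
  | 2, true => (0, 3)
  | 2, false => (1, 2)

/-- The partition of the `Y`-indices orthogonal to a partition of the `X`-indices. -/
def dual : Fin 3 → Fin 3 := ![1, 0, 2]

/-- Whether an exponent in `ℤ/4` is odd. -/
def odd4 (k : Fin 4) : Bool := k.val % 2 == 1

/-- Negation of `k` unless `b` holds. -/
def negUnless (b : Bool) (k : Fin 4) : Fin 4 := bif b then k else ![0, 3, 2, 1] k

/-- The orbit of `D₁^±`: a coordinate of each kind is a power of `i` times another one. -/
def fam1 (t : Fin 3 × Fin 4 × Fin 4) : Set (Fin 8 → ℂ) :=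
  {v ∈ ConeSet |
    coordX v (block t.1 (odd4 t.2.2)).1 = I ^ t.2.1.val * coordX v (block t.1 (odd4 t.2.2)).2 ∧
    coordY v (block (dual t.1) (odd4 t.2.1)).1 =
      I ^ t.2.2.val * coordY v (block (dual t.1) (odd4 t.2.1)).2}

/-- The action of the generators on the indices of `fam1`. -/
def act1 (g : Fin 4) (t : Fin 3 × Fin 4 × Fin 4) : Fin 3 × Fin 4 × Fin 4 :=
  let k := t.2.1
  let l := t.2.2
  ![![(2, negUnless (odd4 l) k, l), (1, negUnless (odd4 l) k, negUnless (odd4 k) l),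
      (0, negUnless (odd4 l) k, l)] t.1,
    ![(0, negUnless (odd4 l) k, negUnless (odd4 k) l), (2, k, negUnless (odd4 k) l),
      (1, k, negUnless (odd4 k) l)] t.1,
    ![(0, negUnless false k, l), (1, k, l + 1), (2, k, l + negUnless (odd4 k) 1)] t.1,
    (dual t.1, l, k)] g

set_option maxHeartbeats 1000000 in
theorem genEquivariant_fam1 : GenEquivariant fam1 act1 where
  pow_four := by decide +kernel
  maps := by
    rintro g ⟨m, k, l⟩ v ⟨hC, hX, hY⟩
    refine ⟨genM_mulVec_mem_ConeSet g hC, ?_⟩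
    have hs := ofReal_sqrt_two_sq
    have hI := Complex.I_sq
    clear hC
    fin_cases g <;> fin_cases m <;> fin_cases k <;> fin_cases l <;>
    simp [genM, U1M, U2M, TM, JM, mkM_mulVec, coordX, coordY, act1, odd4, negUnless,
      dual, block] at hX hY ⊢ <;> grind

theorem exists_foldr_act1 (i : Fin 3 × Fin 4 × Fin 4) :
    ∃ w : List (Fin 4), w.foldr act1 (0, 0, 2) = i := by
  have key : ∀ i, ∃ t : Fin 3 × Fin 4 × Fin 4,
      (![[], [1], [3]] t.1 ++ List.replicate t.2.1.val 2 ++ [1, 0, 3] ++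
        List.replicate t.2.2.val 2 ++ [3] : List (Fin 4)).foldr act1 (0, 0, 2) = i := by
    decide +kernel
  exact (key i).imp' _ fun _ h => h

theorem D1_eq_fam1 : D1 1 = fam1 (0, 0, 2) ∧ D1 (-1) = fam1 (0, 0, 0) := by
  constructor <;> ext v <;>
    simp [D1, fam1, coordX, coordY, odd4, dual, block, sub_eq_zero, add_eq_zero_iff_eq_neg]

theorem eq_of_fam1_subset {i : Fin 3 × Fin 4 × Fin 4} (h : fam1 (0, 0, 2) ⊆ fam1 i) :
    i = (0, 0, 2) := by
  have hs := ofReal_sqrt_two_sq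
  have h1 := @h ![1, 1, 1, -1, 1, 0, 0, 0]
    (by simp [fam1, ConeSet, coordX, coordY, odd4, dual, block])
  have h2 := @h ![(√2 : ℝ), 0, (√2 : ℝ), 0, 1, 1, 0, 0]
    (by simp [fam1, ConeSet, coordX, coordY, odd4, dual, block, hs]; norm_num)
  have h3 := @h ![(√2 : ℝ), 0, I * (√2 : ℝ), 0, 0, 0, 1, 1]
    (by simp [fam1, ConeSet, coordX, coordY, odd4, dual, block, hs, mul_pow]; norm_num)
  obtain ⟨m, k, l⟩ := i
  have h1 := h1.2
  have h2 := h2.2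
  have h3 := h3.2
  have hI : (1 : ℂ) ≠ I := fun h => by simpa using congrArg Complex.im h
  have hI' : (1 : ℂ) ≠ -I := fun h => by simpa using congrArg Complex.im h
  clear h
  fin_cases m <;> fin_cases k <;> fin_cases l <;>
    simp [coordX, coordY, odd4, dual, block] at h1 h2 h3 ⊢ <;> grind

/-- `-1` for `true` and `1` for `false`. -/
def sgn (b : Bool) : ℂ := bif b then -1 else 1

/-- The orbit of `D₂^±`: products over the blocks of dual partitions agree up to sign. -/
def fam2 (t : Fin 3 × Bool × Bool) : Set (Fin 8 → ℂ) :=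
  {v ∈ ConeSet |
    coordX v (block t.1 true).1 * coordX v (block t.1 true).2 =
      sgn t.2.1 * (coordX v (block t.1 false).1 * coordX v (block t.1 false).2) ∧
    coordY v (block (dual t.1) true).1 * coordY v (block (dual t.1) true).2 =
      sgn t.2.2 * (coordY v (block (dual t.1) false).1 * coordY v (block (dual t.1) false).2)}

/-- The action of the generators on the indices of `fam2`. -/
def act2 (g : Fin 4) (t : Fin 3 × Bool × Bool) : Fin 3 × Bool × Bool :=
  ![(![2, 1, 0] t.1, t.2), (![0, 2, 1] t.1, t.2), (t.1, t.2.1, t.2.2 ^^ (t.1 == 0)),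
    (dual t.1, t.2.2, t.2.1)] g

theorem genEquivariant_fam2 : GenEquivariant fam2 act2 where
  pow_four := by decide +kernel
  maps := by
    rintro g ⟨m, s, t⟩ v ⟨hC, hX, hY⟩
    refine ⟨genM_mulVec_mem_ConeSet g hC, ?_⟩
    have hs := ofReal_sqrt_two_sq
    have hI := Complex.I_sq
    clear hC
    fin_cases g <;> fin_cases m <;> cases s <;> cases t <;>
    simp [genM, U1M, U2M, TM, JM, mkM_mulVec, coordX, coordY, act2, sgn,
      dual, block] at hX hY ⊢ <;> grind

theorem exists_foldr_act2 (i : Fin 3 × Bool × Bool) :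
    ∃ w : List (Fin 4), w.foldr act2 (1, true, true) = i := by
  have key : ∀ i, ∃ t : Fin 3 × Bool × Bool,
      (![[], [0], [3]] t.1 ++ List.replicate t.2.1.toNat 2 ++ [0, 1, 3] ++
        List.replicate t.2.2.toNat 2 ++ [3] : List (Fin 4)).foldr act2 (1, true, true) = i := by
    decide +kernel
  exact (key i).imp' _ fun _ h => h

theorem D2_eq_fam2 : D2 1 = fam2 (1, true, true) ∧ D2 (-1) = fam2 (1, true, false) := by
  constructor <;> ext v <;>
    simp [D2, fam2, coordX, coordY, sgn, dual, block, add_eq_zero_iff_eq_neg]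

theorem eq_of_fam2_subset {i : Fin 3 × Bool × Bool} (h : fam2 (1, true, true) ⊆ fam2 i) :
    i = (1, true, true) := by
  have hs := ofReal_sqrt_two_sq
  have h1 := (@h ![1, 1, 1, -1, 1, 0, 0, 0]
    (by simp [fam2, ConeSet, coordX, coordY, dual, block, sgn])).2
  have h2 := (@h ![(√2 : ℝ), 0, (√2 : ℝ), 0, 1, 1, 0, 0]
    (by simp [fam2, ConeSet, coordX, coordY, dual, block, hs]; norm_num)).2
  have h3 := (@h ![(√2 : ℝ), 0, 0, (√2 : ℝ), 1, 0, 0, 1]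
    (by simp [fam2, ConeSet, coordX, coordY, dual, block, hs]; norm_num)).2
  have h4 := (@h ![2, 0, 0, 0, 1, 1, 1, -1]
    (by simp [fam2, ConeSet, coordX, coordY, dual, block, sgn]; norm_num)).2
  obtain ⟨m, s, t⟩ := i
  clear h
  fin_cases m <;> cases s <;> cases t <;>
    simp [coordX, coordY, dual, block, sgn] at h1 h2 h3 h4 ⊢ <;> grind

/-- Addition in `(ℤ/2)²`, on the labels `0, 1, 2, 3` read in binary. -/
def xor4 : Fin 4 → Fin 4 → Fin 4 :=
  ![![0, 1, 2, 3], ![1, 0, 3, 2], ![2, 3, 0, 1], ![3, 2, 1, 0]]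

/-- A linear relation in `x`, with three quadratic relations between `y` and the three Fourier
transforms of its terms. -/
def SkewRel (x y : Fin 4 → ℂ) (α β γ κ : ℂ) (e : Fin 4) : Prop :=
  x 0 + α * x 1 + β * x 2 + γ * x 3 = 0 ∧
  y (xor4 e 1) * (x 0 - α * x 1 + β * x 2 - γ * x 3) = κ * (y (xor4 e 2) * y (xor4 e 3)) ∧
  y (xor4 e 2) * (x 0 + α * x 1 - β * x 2 - γ * x 3) = κ * (y (xor4 e 1) * y (xor4 e 3)) ∧
  y (xor4 e 3) * (x 0 - α * x 1 - β * x 2 + γ * x 3) = κ * (y (xor4 e 1) * y (xor4 e 2))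

/-- The label whose binary digits are the parities of `a` and `b`. -/
def parity (a b : Fin 4) : Fin 4 :=
  bif odd4 a then (bif odd4 b then 3 else 1) else (bif odd4 b then 2 else 0)

/-- The orbit of `D₃^±`; the first index tells whether the linear relation is one in the
`Y`-coordinates. -/
def fam3 (t : Bool × Fin 4 × Fin 4 × Bool × Bool) : Set (Fin 8 → ℂ) :=
  let (y, a, b, c, s) := t
  {v ∈ ConeSet | SkewRel (bif y then coordY v else coordX v) (bif y then coordX v else coordY v)
    (I ^ a.val) (I ^ b.val) (sgn c * (I ^ a.val * I ^ b.val))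
    (sgn s * bif y then 2 * ((√2 : ℝ) : ℂ) else ((√2 : ℝ) : ℂ)) (parity a b)}

/-- The action on indices of exchanging `x 1` and `x 3`. -/
def swap13 : Fin 4 × Fin 4 × Bool × Bool → Fin 4 × Fin 4 × Bool × Bool
  | (a, b, c, s) => (a + b + (bif c then 2 else 0), b, c ^^ odd4 b, s)

/-- The action on indices of exchanging `x 2` and `x 3`. -/
def swap23 : Fin 4 × Fin 4 × Bool × Bool → Fin 4 × Fin 4 × Bool × Bool
  | (a, b, c, s) => (a, a + b + (bif c then 2 else 0), c ^^ odd4 a, s)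

/-- The action of the generators on the indices of `fam3`. -/
def act3 : Fin 4 → Bool × Fin 4 × Fin 4 × Bool × Bool → Bool × Fin 4 × Fin 4 × Bool × Bool
  | 0, (false, t) => (false, swap13 t)
  | 0, (true, t) => (true, swap23 t)
  | 1, (false, t) => (false, swap23 t)
  | 1, (true, t) => (true, swap13 t)
  | 2, (false, a, b, c, s) =>
    (false, negUnless false a, b + (bif c then 2 else 0), c, s ^^ decide (a < 2))
  | 2, (true, a, t) => (true, a + 1, t)
  | 3, (y, t) => (!y, t)

section SkewRel

variable {x y : Fin 4 → ℂ} {α β γ κ : ℂ} {e : Fin 4}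

theorem SkewRel.swap13 (h : SkewRel x y α β γ κ e) :
    SkewRel ![x 0, x 3, x 2, x 1] ![y 0, y 1, y 3, y 2] γ β α κ (![0, 1, 3, 2] e) := by
  obtain ⟨h0, h1, h2, h3⟩ := h
  fin_cases e <;> simp [SkewRel, xor4] at h0 h1 h2 h3 ⊢ <;> grind

theorem SkewRel.swap23 (h : SkewRel x y α β γ κ e) :
    SkewRel ![x 0, x 1, x 3, x 2] ![y 0, y 3, y 2, y 1] α γ β κ (![0, 3, 2, 1] e) := by
  obtain ⟨h0, h1, h2, h3⟩ := h
  fin_cases e <;> simp [SkewRel, xor4] at h0 h1 h2 h3 ⊢ <;> grind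

theorem SkewRel.shift_left (h : SkewRel x y α β γ κ e) {α' : ℂ} (hα : α' * α = 1) :
    SkewRel ![x 1, x 0, x 3, x 2] ![y 0, -I * y 1, y 2, -I * y 3] α' (α' * γ) (α' * β)
      (-(bif odd4 e then I else 1) * α' * κ) e := by
  obtain ⟨h0, h1, h2, h3⟩ := h
  have hI := Complex.I_sq
  fin_cases e <;> simp [SkewRel, xor4, odd4] at h0 h1 h2 h3 ⊢ <;> grind

theorem SkewRel.shift_right (h : SkewRel x y α β γ κ e) :
    SkewRel ![x 0, -I * x 1, x 2, -I * x 3] ![y 1, y 0, y 3, y 2] (I * α) β (I * γ) κ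
      (xor4 e 1) := by
  obtain ⟨h0, h1, h2, h3⟩ := h
  have hI := Complex.I_sq
  fin_cases e <;> simp [SkewRel, xor4] at h0 h1 h2 h3 ⊢ <;> grind

theorem SkewRel.smul (h : SkewRel x y α β γ κ e) {c d κ' : ℂ} (hκ : κ' * d = c * κ) :
    SkewRel (c • x) (d • y) α β γ κ' e := by
  obtain ⟨h0, h1, h2, h3⟩ := h
  simp only [SkewRel, Pi.smul_apply, smul_eq_mul]
  refine ⟨?_, ?_, ?_, ?_⟩ <;> grind

theorem SkewRel.of_eq (h : SkewRel x y α β γ κ e) {x' y' : Fin 4 → ℂ} {α' β' γ' κ' : ℂ}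
    {e' : Fin 4} (hx : x' = x) (hy : y' = y) (hα : α' = α) (hβ : β' = β) (hγ : γ' = γ)
    (hκ : κ' = κ) (he : e' = e) : SkewRel x' y' α' β' γ' κ' e' := by
  subst hx hy hα hβ hγ hκ he
  exact h

end SkewRel

theorem I_pow_add_sgn (a b : Fin 4) (c : Bool) :
    I ^ (a + b + (bif c then 2 else 0)).val = sgn c * (I ^ a.val * I ^ b.val) := by
  fin_cases a <;> fin_cases b <;> cases c <;> simp [sgn, Complex.I_pow_three]

theorem sgn_xor_odd4 (c : Bool) (a : Fin 4) :
    sgn (c ^^ odd4 a) = sgn c * (I ^ a.val * I ^ a.val) := by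
  cases c <;> fin_cases a <;> simp [sgn, odd4, Complex.I_pow_three]

theorem sgn_mul_self (c : Bool) : sgn c * sgn c = 1 := by
  cases c <;> simp [sgn]

theorem I_pow_val_pow_four (a : Fin 4) : (I ^ a.val) ^ 4 = 1 := by
  rw [← pow_mul, mul_comm, pow_mul, Complex.I_pow_four, one_pow]

theorem I_pow_add_one (a : Fin 4) : I ^ (a + 1).val = I * I ^ a.val := by
  fin_cases a <;> simp [Complex.I_pow_three]

theorem coordX_U1 (v : Fin 8 → ℂ) : coordX (genM 0 *ᵥ v) =
    ![coordX v 0, coordX v 3, coordX v 2, coordX v 1] := by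
  simp [genM, U1M, mkM_mulVec, coordX]

theorem coordY_U1 (v : Fin 8 → ℂ) : coordY (genM 0 *ᵥ v) =
    ![coordY v 0, coordY v 1, coordY v 3, coordY v 2] := by
  simp [genM, U1M, mkM_mulVec, coordY]

theorem coordX_U2 (v : Fin 8 → ℂ) : coordX (genM 1 *ᵥ v) =
    ![coordX v 0, coordX v 1, coordX v 3, coordX v 2] := by
  simp [genM, U2M, mkM_mulVec, coordX]

theorem coordY_U2 (v : Fin 8 → ℂ) : coordY (genM 1 *ᵥ v) =
    ![coordY v 0, coordY v 3, coordY v 2, coordY v 1] := by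
  simp [genM, U2M, mkM_mulVec, coordY]

theorem coordX_T (v : Fin 8 → ℂ) : coordX (genM 2 *ᵥ v) =
    ![coordX v 1, coordX v 0, coordX v 3, coordX v 2] := by
  simp [genM, TM, mkM_mulVec, coordX]

theorem coordY_T (v : Fin 8 → ℂ) : coordY (genM 2 *ᵥ v) =
    ![coordY v 0, -I * coordY v 1, coordY v 2, -I * coordY v 3] := by
  simp [genM, TM, mkM_mulVec, coordY]

theorem coordX_J (v : Fin 8 → ℂ) : coordX (genM 3 *ᵥ v) = ((√2 : ℝ) / 2 : ℂ) • coordY v := by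
  simp [genM, JM, mkM_mulVec, coordX, coordY]

theorem coordY_J (v : Fin 8 → ℂ) : coordY (genM 3 *ᵥ v) = ((√2 : ℝ) : ℂ) • coordX v := by
  simp [genM, JM, mkM_mulVec, coordX, coordY]

theorem genEquivariant_fam3 : GenEquivariant fam3 act3 where
  pow_four := by decide +kernel
  maps := by
    rintro g ⟨y, a, b, c, s⟩ v ⟨hC, h⟩
    refine ⟨genM_mulVec_mem_ConeSet g hC, ?_⟩
    have hs := ofReal_sqrt_two_sq
    have hc := sgn_mul_self c
    have ha := I_pow_val_pow_four a
    have hb := I_pow_val_pow_four b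
    have h13 : parity (a + b + bif c then 2 else 0) b = ![0, 1, 3, 2] (parity a b) := by
      clear * -
      revert a b c
      decide
    have h23 : parity a (a + b + bif c then 2 else 0) = ![0, 3, 2, 1] (parity a b) := by
      clear * -
      revert a b c
      decide
    have e13 : sgn (c ^^ odd4 b) * (I ^ (a + b + bif c then 2 else 0).val * I ^ b.val) =
        I ^ a.val := by
      rw [I_pow_add_sgn, sgn_xor_odd4]
      grind
    have e23 : sgn (c ^^ odd4 a) * (I ^ a.val * I ^ (a + b + bif c then 2 else 0).val) =
        I ^ b.val := by
      rw [I_pow_add_sgn, sgn_xor_odd4]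
      grind
    clear hC
    fin_cases g
    · cases y
      · exact h.swap13.of_eq (coordX_U1 v) (coordY_U1 v) (I_pow_add_sgn a b c) rfl e13 rfl h13
      · exact h.swap23.of_eq (coordY_U1 v) (coordX_U1 v) rfl (I_pow_add_sgn a b c) e23 rfl h23
    · cases y
      · exact h.swap23.of_eq (coordX_U2 v) (coordY_U2 v) rfl (I_pow_add_sgn a b c) e23 rfl h23
      · exact h.swap13.of_eq (coordY_U2 v) (coordX_U2 v) (I_pow_add_sgn a b c) rfl e13 rfl h13
    · cases y
      · have hα : I ^ (negUnless false a).val * I ^ a.val = 1 := by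
          clear * -
          fin_cases a <;> simp [negUnless]
        have hβ : I ^ (b + bif c then 2 else 0).val = sgn c * I ^ b.val := by
          clear * -
          fin_cases b <;> cases c <;> simp [sgn, Complex.I_pow_three]
        refine (h.shift_left hα).of_eq (coordX_T v) (coordY_T v) rfl ?_ ?_ ?_ ?_
        · refine hβ.trans ?_
          grind
        · refine (congrArg (fun z => sgn c * (I ^ (negUnless false a).val * z)) hβ).trans ?_
          grind
        · clear * -
          fin_cases a <;> fin_cases b <;> cases s <;>
            simp [sgn, negUnless, odd4, parity, Complex.I_pow_three]
        · clear * -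
          change parity (negUnless false a) (b + bif c then 2 else 0) = parity a b
          revert a b c
          decide
      · refine h.shift_right.of_eq (coordY_T v) (coordX_T v) (I_pow_add_one a) rfl ?_ rfl ?_
        · change sgn c * (I ^ (a + 1).val * I ^ b.val) = _
          rw [I_pow_add_one]
          ring
        · clear * -
          change parity (a + 1) b = xor4 (parity a b) 1
          revert a b
          decide
    · cases y
      · refine (h.smul (c := (√2 : ℝ)) (d := (√2 : ℝ) / 2) (κ' := sgn s * (2 * (√2 : ℝ))) ?_).of_eq
          (coordY_J v) (coordX_J v) rfl rfl rfl rfl rfl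
        simp only [cond_false]
        ring
      · refine (h.smul (c := (√2 : ℝ) / 2) (d := (√2 : ℝ)) (κ' := sgn s * (√2 : ℝ)) ?_).of_eq
          (coordX_J v) (coordY_J v) rfl rfl rfl rfl rfl
        simp only [cond_true]
        ring

theorem exists_foldr_act3 (i : Bool × Fin 4 × Fin 4 × Bool × Bool) :
    ∃ w : List (Fin 4), w.foldr act3 (false, 2, 2, true, true) = i := by
  have key : ∀ i, ∃ t : Bool × Fin 4 × Fin 4 × Bool × Bool,
      (List.replicate t.1.toNat 3 ++
        (List.replicate t.2.1.val [3, 2, 3]).flatten ++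
        (List.replicate t.2.2.1.val [3, 1, 0, 2, 3, 1, 0]).flatten ++
        (List.replicate t.2.2.2.1.toNat [3, 2, 0, 2, 2, 2, 1, 0, 2, 3, 0, 1, 0]).flatten ++
        (List.replicate t.2.2.2.2.toNat [3, 2, 2, 3, 2, 3, 2, 2, 3, 2, 2, 2]).flatten :
          List (Fin 4)).foldr
          act3 (false, 2, 2, true, true) = i := by
    decide +kernel
  exact (key i).imp' _ fun _ h => h

theorem D3_eq_SkewRel {ε : ℂ} (hε : ε ^ 2 = 1) :
    D3 ε = {v ∈ ConeSet |
      SkewRel (coordX v) (coordY v) (-1) (-1) (-1) (-ε * (√2 : ℝ)) 0} := by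
  have hs := ofReal_sqrt_two_sq
  ext v
  constructor
  · rintro ⟨hC, h0, h1⟩
    refine ⟨hC, ?_⟩
    obtain ⟨-, c1, c2, c3⟩ := hC
    simp only [SkewRel, coordX, coordY, xor4, Matrix.cons_val]
    by_cases hz : v 5 + v 7 = 0
    · have h2 : v 2 = 0 := by grind
      have h3 : v 3 = 0 := by grind
      grind
    · refine ⟨by grind, by grind, mul_left_cancel₀ hz ?_, mul_left_cancel₀ hz ?_⟩ <;> grind
  · rintro ⟨hC, h0, h1, -, -⟩
    refine ⟨hC, ?_⟩
    simp only [coordX, coordY, xor4, Matrix.cons_val] at h0 h1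
    grind

theorem D3_eq_fam3 :
    D3 1 = fam3 (false, 2, 2, true, true) ∧ D3 (-1) = fam3 (false, 2, 2, true, false) := by
  constructor <;> rw [D3_eq_SkewRel (by norm_num)] <;> ext v <;>
    simp [fam3, parity, odd4, sgn]

theorem eq_of_fam3_subset {i : Bool × Fin 4 × Fin 4 × Bool × Bool}
    (h : fam3 (false, 2, 2, true, true) ⊆ fam3 i) : i = (false, 2, 2, true, true) := by
  have hs := ofReal_sqrt_two_sq
  have hs0 : ((√2 : ℝ) : ℂ) ≠ 0 := by simp
  obtain ⟨r, hr⟩ := IsAlgClosed.exists_pow_nat_eq (12 : ℂ) (n := 2) (by norm_num)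
  rw [← D3_eq_fam3.1] at h
  generalize hw : ((√2 : ℝ) : ℂ) = w at *
  have h1 := (@h ![w, 0, w, 0, 1, 1, 0, 0]
    (by simp [D3, ConeSet, hs]; norm_num)).2
  have h1' := (@h ![w, 0, -w, 0, 1, 1, 0, 0]
    (by simp [D3, ConeSet, hs]; norm_num)).2
  have h2 := (@h ![w, w, 0, 0, 1, 0, 1, 0]
    (by simp [D3, ConeSet, hs]; norm_num)).2
  have h3 := (@h ![w, 0, 0, w, 1, 0, 0, 1]
    (by simp [D3, ConeSet, hs]; norm_num)).2
  have h4 := (@h ![r, -2 * w, -2 * w, -2 * w, 3, 1, 1, 1]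
    (by simp [D3, ConeSet, hr, hw, mul_pow, hs]; grind)).2
  obtain ⟨y, a, b, c, s⟩ := i
  clear h
  cases y
  · have ha : a = 2 := by
      replace h1 := h1.1
      clear h1' h2 h3 h4
      fin_cases a <;> simp [coordX, Complex.I_pow_three, Complex.ext_iff] at h1 ⊢
    have hb : b = 2 := by
      replace h2 := h2.1
      clear h1 h1' h3 h4
      fin_cases b <;> simp [coordX, Complex.I_pow_three, Complex.ext_iff] at h2 ⊢
    subst ha hb
    have hc : c = true := by
      replace h3 := h3.1
      clear h1 h1' h2 h4
      cases c <;> simp [coordX, sgn] at h3 ⊢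
    subst hc
    have hs : s = true := by
      replace h4 := h4.2.1
      clear h1 h1' h2 h3
      cases s <;> simp [coordX, coordY, xor4, sgn, parity, odd4] at h4 ⊢
      grind
    rw [hs]
  · exfalso
    have e1 := h1.1
    have e2 := h1'.1
    simp [coordY] at e1 e2
    grind

/-- For each `i ∈ {1,2,3}` the divisors `Dᵢ⁺` and `Dᵢ⁻` lie in the same `𝒢`-orbit, and
the `𝒢`-orbit of `Dᵢ^±` has `48` elements for `i = 1`, `12` elements for `i = 2` and
`128` elements for `i = 3`. -/
theorem statement16 :
    (∃ g ∈ GG, actSet g (D1 1) = D1 (-1)) ∧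
    (∃ g ∈ GG, actSet g (D2 1) = D2 (-1)) ∧
    (∃ g ∈ GG, actSet g (D3 1) = D3 (-1)) ∧
    Nat.card (orbitOf (D1 1)) = 48 ∧
    Nat.card (orbitOf (D2 1)) = 12 ∧
    Nat.card (orbitOf (D3 1)) = 128 := by
  obtain ⟨w₁, hw₁⟩ := exists_foldr_act1 (0, 0, 0)
  obtain ⟨w₂, hw₂⟩ := exists_foldr_act2 (1, true, false)
  obtain ⟨w₃, hw₃⟩ := exists_foldr_act3 (false, 2, 2, true, false)
  rw [D1_eq_fam1.1, D1_eq_fam1.2, D2_eq_fam2.1, D2_eq_fam2.2, D3_eq_fam3.1, D3_eq_fam3.2,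
    ← hw₁, ← hw₂, ← hw₃,
    genEquivariant_fam1.card_orbitOf exists_foldr_act1 fun _ h => eq_of_fam1_subset h,
    genEquivariant_fam2.card_orbitOf exists_foldr_act2 fun _ h => eq_of_fam2_subset h,
    genEquivariant_fam3.card_orbitOf exists_foldr_act3 fun _ h => eq_of_fam3_subset h]
  exact ⟨genEquivariant_fam1.exists_actSet_eq_foldr _ _,
    genEquivariant_fam2.exists_actSet_eq_foldr _ _,
    genEquivariant_fam3.exists_actSet_eq_foldr _ _, by simp, by simp, by simp⟩
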